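/- arXiv:1108.3949 — 2 statements merged into one kernel-verified Lean document; each statement's English description precedes it below -/
import Mathlib

section
/- Let V : ℝ → ℝ be continuous and 1-periodic, let V_min and V_max be its minimal and maximal values, and let h satisfy V_min ≤ h < V_max. Then every connected component of the set K_h := {s ∈ ℝ : V(s) ≤ h} is compact and has diameter strictly less than 1. -/
/-- An order-connected set of reals that avoids some translate class `a + ℤ` contains no two
points at distance at least `1`. -/
lemma Set.OrdConnected.sub_lt_one_of_forall_add_int_notMem {C : Set ℝ} (hC : C.OrdConnected)
    {a : ℝ} (ha : ∀ n : ℤ, a + n ∉ C) {x y : ℝ} (hx : x ∈ C) (hy : y ∈ C) : y - x < 1 := by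
  by_contra! hxy
  refine ha ⌈x - a⌉ (hC.out hx hy ⟨?_, ?_⟩)
  · linarith [Int.le_ceil (x - a)]
  · linarith [Int.ceil_lt_add_one (x - a)]

/-- Connected components of a closed set are closed. -/
lemma IsClosed.isClosed_connectedComponentIn {X : Type*} [TopologicalSpace X] {F : Set X}
    (hF : IsClosed F) {x : X} (hx : x ∈ F) : IsClosed (connectedComponentIn F x) :=
  isClosed_of_closure_subset <|
    isPreconnected_connectedComponentIn.closure.subset_connectedComponentIn
      (subset_closure (mem_connectedComponentIn hx))
      (closure_minimal (connectedComponentIn_subset F x) hF)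

/-- A nonempty closed set of reals whose points are pairwise at distance less than `1` is compact
of diameter less than `1`. -/
lemma IsClosed.isCompact_and_diam_lt_one {C : Set ℝ} (hC : IsClosed C) (hne : C.Nonempty)
    (hlt : ∀ x ∈ C, ∀ y ∈ C, y - x < 1) : IsCompact C ∧ Metric.diam C < 1 := by
  have hb : Bornology.IsBounded C := Metric.isBounded_iff.2 ⟨1, fun x hx y hy => by
    rw [Real.dist_eq, abs_le]
    constructor <;> linarith [hlt x hx y hy, hlt y hy x hx]⟩
  have hc : IsCompact C := Metric.isCompact_of_isClosed_isBounded hC hb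
  refine ⟨hc, ?_⟩
  rw [Real.diam_eq hb]
  exact hlt _ (hc.sInf_mem hne) _ (hc.sSup_mem hne)

/-- Let `V : ℝ → ℝ` be continuous and 1-periodic, with attained minimum `Vmin` and
attained maximum `Vmax`, and let `Vmin ≤ h < Vmax`. Then every connected component of
`K_h = {s | V s ≤ h}` is compact and has diameter strictly less than 1. -/
theorem stmt_3 (V : ℝ → ℝ) (hV : Continuous V) (hper : ∀ s : ℝ, V (s + 1) = V s)
    (Vmin Vmax : ℝ)
    (hminlb : ∀ s : ℝ, Vmin ≤ V s) (hminatt : ∃ s : ℝ, V s = Vmin)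
    (hmaxub : ∀ s : ℝ, V s ≤ Vmax) (hmaxatt : ∃ s : ℝ, V s = Vmax)
    (h : ℝ) (h1 : Vmin ≤ h) (h2 : h < Vmax) :
    ∀ s ∈ {t : ℝ | V t ≤ h},
      IsCompact (connectedComponentIn {t : ℝ | V t ≤ h} s) ∧
      Metric.diam (connectedComponentIn {t : ℝ | V t ≤ h} s) < 1 := by
  intro s hs
  obtain ⟨a, ha⟩ := hmaxatt
  have hclosed : IsClosed {t : ℝ | V t ≤ h} := isClosed_le hV continuous_const
  have hmax (n : ℤ) : a + n ∉ connectedComponentIn {t : ℝ | V t ≤ h} s := fun hn => by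
    have hle : V (a + n) ≤ h := connectedComponentIn_subset {t : ℝ | V t ≤ h} s hn
    have hVn : V (a + n) = V a := by
      simpa using (show Function.Periodic V 1 from hper).int_mul n a
    linarith
  exact (hclosed.isClosed_connectedComponentIn hs).isCompact_and_diam_lt_one
    ⟨s, mem_connectedComponentIn hs⟩ fun x hx y hy =>
      isPreconnected_connectedComponentIn.ordConnected.sub_lt_one_of_forall_add_int_notMem
        hmax hx hy
end

section
/- Let V : ℝ → ℝ be continuous and 1-periodic, let V_min and V_max be its minimal and maximal values, and let h satisfy V_min ≤ h < V_max. Then the set K_h := {s ∈ ℝ : V(s) ≤ h} has infinitely many connected components; more precisely, K_h is nonempty, invariant under the translation s ↦ s + 1, and the connected components in K_h of the points s₀ + k, k ∈ ℤ, for any fixed s₀ ∈ K_h, are pairwise distinct. -/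
/-- If a sublevel set of a 1-periodic function is not the whole line, then two of its points at
distance at least one lie in different connected components. -/
lemma connectedComponentIn_sublevel_ne_of_add_one_le {V : ℝ → ℝ} (hper : Function.Periodic V 1)
    {h m x y : ℝ} (hm : h < V m) (hx : V x ≤ h) (hy : V y ≤ h) (hxy : x + 1 ≤ y) :
    connectedComponentIn {t : ℝ | V t ≤ h} x ≠ connectedComponentIn {t : ℝ | V t ≤ h} y := by
  intro heq
  obtain ⟨z, hz, hVz⟩ := hper.exists_mem_Ico one_pos m x
  have hxC : x ∈ connectedComponentIn {t : ℝ | V t ≤ h} x := mem_connectedComponentIn hx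
  have hyC : y ∈ connectedComponentIn {t : ℝ | V t ≤ h} x := heq ▸ mem_connectedComponentIn hy
  have hzC := isPreconnected_connectedComponentIn.ordConnected.out hxC hyC
    ⟨hz.1, hz.2.le.trans hxy⟩
  have hzK : z ∈ {t : ℝ | V t ≤ h} := connectedComponentIn_subset _ _ hzC
  exact hm.not_ge (hVz.trans_le hzK)

/-- Let `V : ℝ → ℝ` be continuous and 1-periodic, with attained minimum `Vmin` and
attained maximum `Vmax`, and let `Vmin ≤ h < Vmax`. Then `K_h = {s | V s ≤ h}` is
nonempty, invariant under `s ↦ s + 1`, the connected components in `K_h` of the points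
`s₀ + k`, `k ∈ ℤ`, for any fixed `s₀ ∈ K_h`, are pairwise distinct, and `K_h` has
infinitely many connected components. -/
theorem stmt_4 (V : ℝ → ℝ) (hV : Continuous V) (hper : ∀ s : ℝ, V (s + 1) = V s)
    (Vmin Vmax : ℝ)
    (hminlb : ∀ s : ℝ, Vmin ≤ V s) (hminatt : ∃ s : ℝ, V s = Vmin)
    (hmaxub : ∀ s : ℝ, V s ≤ Vmax) (hmaxatt : ∃ s : ℝ, V s = Vmax)
    (h : ℝ) (h1 : Vmin ≤ h) (h2 : h < Vmax) :
    {t : ℝ | V t ≤ h}.Nonempty ∧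
    (∀ s : ℝ, s ∈ {t : ℝ | V t ≤ h} ↔ s + 1 ∈ {t : ℝ | V t ≤ h}) ∧
    (∀ s₀ ∈ {t : ℝ | V t ≤ h}, Function.Injective
      (fun k : ℤ => connectedComponentIn {t : ℝ | V t ≤ h} (s₀ + k))) ∧
    {C : Set ℝ | ∃ s ∈ {t : ℝ | V t ≤ h},
      C = connectedComponentIn {t : ℝ | V t ≤ h} s}.Infinite := by
  have hP : Function.Periodic V 1 := hper
  obtain ⟨a, ha⟩ := hminatt
  obtain ⟨m, hm⟩ := hmaxatt
  have haK : V a ≤ h := ha.trans_le h1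
  have hmK : h < V m := hm.symm ▸ h2
  have hshift (s : ℝ) (hs : V s ≤ h) (k : ℤ) : V (s + k) ≤ h := by
    simpa using (hP.int_mul k s).trans_le hs
  have hinj : ∀ s₀ ∈ {t : ℝ | V t ≤ h}, Function.Injective
      (fun k : ℤ => connectedComponentIn {t : ℝ | V t ≤ h} (s₀ + k)) := by
    intro s₀ hs₀
    refine Function.Injective.of_lt_imp_ne fun j k hjk => ?_
    have hjk' : (j : ℝ) + 1 ≤ k := by exact_mod_cast hjk
    exact connectedComponentIn_sublevel_ne_of_add_one_le hP hmK (hshift s₀ hs₀ j)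
      (hshift s₀ hs₀ k) (by linarith)
  refine ⟨⟨a, haK⟩, fun s => by simp [hper s], hinj, ?_⟩
  exact Set.infinite_of_injective_forall_mem (hinj a haK)
    fun k => ⟨a + k, hshift a haK k, rfl⟩
end
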